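/- Let (σ_j)_{j ≥ 0} be the Rudin–Shapiro sequence. There exists a constant C > 0 such that for every finite interval I ⊂ ℤ_{≥0} and every θ ∈ ℝ: |∑_{j ∈ I} σ_j e(jθ)| ≤ C |I|^{1/2}. -/

import Mathlib

/-- `e(θ) = e^{2πiθ}`. -/
noncomputable def eC (θ : ℝ) : ℂ := Complex.exp (2 * Real.pi * Complex.I * θ)

/-- `rsExp j` counts occurrences of the pattern `11` in the binary expansion of `j`. -/
def rsExp (j : ℕ) : ℕ :=
  ((Finset.range j).filter fun i => j.testBit i ∧ j.testBit (i + 1)).card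

/-- The Rudin–Shapiro sequence `σ_j = (-1)^{a_j}`. -/
def rudinShapiro (j : ℕ) : ℤ := (-1) ^ rsExp j

open Finset in
theorem rsExp_eq_sum {j N : ℕ} (h : j ≤ N) :
    rsExp j = ∑ i ∈ range N, if j.testBit i ∧ j.testBit (i + 1) then 1 else 0 := by
  rw [rsExp, card_filter]
  refine sum_subset (range_mono h) fun i _ hi => ?_
  have hj : j < 2 ^ i := lt_of_le_of_lt (by simpa using hi) Nat.lt_two_pow_self
  simp [Nat.testBit_lt_two_pow hj]

theorem rsExp_two_mul (n : ℕ) : rsExp (2 * n) = rsExp n := by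
  rw [rsExp_eq_sum (show 2 * n ≤ 2 * n + 1 by omega), Finset.sum_range_succ',
    rsExp_eq_sum (show n ≤ 2 * n by omega)]
  simp [Nat.testBit_succ]

theorem rsExp_two_mul_add_one (n : ℕ) : rsExp (2 * n + 1) = rsExp n + n % 2 := by
  rw [rsExp_eq_sum le_rfl, Finset.sum_range_succ', rsExp_eq_sum (show n ≤ 2 * n by omega)]
  have h : (2 * n + 1) / 2 = n := by omega
  rcases Nat.mod_two_eq_zero_or_one n with hn | hn <;> simp [Nat.testBit_succ, h, hn]

theorem rudinShapiro_two_mul (n : ℕ) : rudinShapiro (2 * n) = rudinShapiro n := by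
  rw [rudinShapiro, rsExp_two_mul, rudinShapiro]

theorem rudinShapiro_two_mul_add_one (n : ℕ) :
    rudinShapiro (2 * n + 1) = rudinShapiro n * (-1) ^ n := by
  rw [rudinShapiro, rsExp_two_mul_add_one, rudinShapiro, pow_add, ← neg_one_pow_eq_pow_mod_two]

theorem norm_rudinShapiro (n : ℕ) : ‖(rudinShapiro n : ℂ)‖ = 1 := by
  simp [rudinShapiro]

/-- The Rudin–Shapiro polynomial `∑_{a ≤ j < b} σ_j z ^ j`. -/
noncomputable def rsPoly (a b : ℕ) (z : ℂ) : ℂ :=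
  ∑ j ∈ Finset.Ico a b, (rudinShapiro j : ℂ) * z ^ j

/-- The sum `|P(z)|² + |P(-z)|²` for the Rudin–Shapiro polynomial `P` on `[a, b)`. -/
noncomputable def rsEnergy (a b : ℕ) (z : ℂ) : ℝ :=
  ‖rsPoly a b z‖ ^ 2 + ‖rsPoly a b (-z)‖ ^ 2

theorem rsPoly_two_mul (a b : ℕ) (z : ℂ) :
    rsPoly (2 * a) (2 * b) z = rsPoly a b (z ^ 2) + z * rsPoly a b (-z ^ 2) := by
  rcases le_total b a with h | h
  · simp [rsPoly, h]
  induction b, h using Nat.le_induction with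
  | base => simp [rsPoly]
  | succ b hab ih =>
    simp only [rsPoly] at ih ⊢
    rw [show 2 * (b + 1) = 2 * b + 1 + 1 by ring, Finset.sum_Ico_succ_top (by omega),
      Finset.sum_Ico_succ_top (by omega), Finset.sum_Ico_succ_top hab,
      Finset.sum_Ico_succ_top hab, ih, rudinShapiro_two_mul, rudinShapiro_two_mul_add_one,
      neg_pow (z ^ 2)]
    push_cast
    ring

theorem rsEnergy_two_mul (a b : ℕ) {z : ℂ} (hz : ‖z‖ = 1) :
    rsEnergy (2 * a) (2 * b) z = 2 * rsEnergy a b (z ^ 2) := by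
  have h := parallelogram_law_with_norm ℝ (rsPoly a b (z ^ 2)) (z * rsPoly a b (-z ^ 2))
  rw [norm_mul, hz] at h
  rw [rsEnergy, rsEnergy, rsPoly_two_mul, rsPoly_two_mul, neg_sq, neg_mul, ← sub_eq_add_neg]
  linarith

theorem sq_norm_add_le {u v x y : ℂ} {M : ℝ} (hM : 0 ≤ M) (hx : ‖x‖ = 1) (hy : ‖y‖ = 1)
    (h : ‖u‖ ^ 2 + ‖v‖ ^ 2 ≤ M ^ 2) : ‖u + x‖ ^ 2 + ‖v + y‖ ^ 2 ≤ (M + 3 / 2) ^ 2 := by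
  have hu : ‖u + x‖ ^ 2 ≤ (‖u‖ + 1) ^ 2 := by
    gcongr
    exact (norm_add_le u x).trans_eq (by rw [hx])
  have hv : ‖v + y‖ ^ 2 ≤ (‖v‖ + 1) ^ 2 := by
    gcongr
    exact (norm_add_le v y).trans_eq (by rw [hy])
  have huv : ‖u‖ + ‖v‖ ≤ 3 / 2 * M :=
    (abs_le_of_sq_le_sq' (by nlinarith [sq_nonneg (‖u‖ - ‖v‖)]) (by positivity)).2
  nlinarith

theorem norm_rudinShapiro_mul_pow (j : ℕ) {z : ℂ} (hz : ‖z‖ = 1) :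
    ‖(rudinShapiro j : ℂ) * z ^ j‖ = 1 := by
  rw [norm_mul, norm_pow, hz, norm_rudinShapiro, one_pow, one_mul]

theorem rsEnergy_succ_top_le {a b : ℕ} (hab : a ≤ b) {z : ℂ} (hz : ‖z‖ = 1) {M : ℝ} (hM : 0 ≤ M)
    (h : rsEnergy a b z ≤ M ^ 2) : rsEnergy a (b + 1) z ≤ (M + 3 / 2) ^ 2 := by
  rw [rsEnergy, rsPoly, rsPoly, Finset.sum_Ico_succ_top hab, Finset.sum_Ico_succ_top hab]
  exact sq_norm_add_le hM (norm_rudinShapiro_mul_pow b hz)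
    (norm_rudinShapiro_mul_pow b (by rwa [norm_neg])) h

theorem rsEnergy_pred_bot_le {a b : ℕ} (hab : a < b) {z : ℂ} (hz : ‖z‖ = 1) {M : ℝ} (hM : 0 ≤ M)
    (h : rsEnergy (a + 1) b z ≤ M ^ 2) : rsEnergy a b z ≤ (M + 3 / 2) ^ 2 := by
  rw [rsEnergy, rsPoly, rsPoly, Finset.sum_eq_sum_Ico_succ_bot hab,
    Finset.sum_eq_sum_Ico_succ_bot hab, add_comm, add_comm (_ * (-z) ^ a),
    add_comm (_ * z ^ a), add_comm (‖_‖ ^ 2)]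
  exact sq_norm_add_le hM (norm_rudinShapiro_mul_pow a hz)
    (norm_rudinShapiro_mul_pow a (by rwa [norm_neg])) h

theorem norm_rsPoly_le (a b : ℕ) {z : ℂ} (hz : ‖z‖ = 1) : ‖rsPoly a b z‖ ≤ (b - a : ℕ) := by
  refine (norm_sum_le _ _).trans_eq ?_
  rw [Finset.sum_congr rfl fun j _ => norm_rudinShapiro_mul_pow j hz]
  simp

theorem rsEnergy_le (n : ℕ) (hn : 1 ≤ n) (a : ℕ) {z : ℂ} (hz : ‖z‖ = 1) :
    rsEnergy a (a + n) z ≤ (10 * √n - 8) ^ 2 := by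
  induction n using Nat.strong_induction_on generalizing a z with
  | _ n ih =>
  have hs2 : (1.4 : ℝ) ≤ √2 := Real.le_sqrt_of_sq_le (by norm_num)
  rcases Nat.lt_or_ge n 3 with h3 | h3
  · have h1 := norm_rsPoly_le a (a + n) hz
    have h2 := norm_rsPoly_le a (a + n) (z := -z) (by rwa [norm_neg])
    rw [Nat.add_sub_cancel_left] at h1 h2
    have h4 : rsEnergy a (a + n) z ≤ (n : ℝ) ^ 2 + (n : ℝ) ^ 2 := by
      unfold rsEnergy; gcongr
    refine h4.trans ?_
    interval_cases n
    · norm_num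
    · push_cast
      nlinarith
  obtain ⟨c, d, s, t, hs, ht, ha, hb, hcd⟩ : ∃ c d s t : ℕ, s ≤ 1 ∧ t ≤ 1 ∧
      a + s = 2 * c ∧ a + n = 2 * d + t ∧ c < d :=
    ⟨(a + 1) / 2, (a + n) / 2, a % 2, (a + n) % 2, by omega, by omega, by omega, by omega,
      by omega⟩
  obtain ⟨m, rfl⟩ := Nat.exists_eq_add_of_lt hcd
  have hm := ih (m + 1) (by omega) (by omega) c (z := z ^ 2) (by rw [norm_pow, hz, one_pow])
  set M : ℝ := 10 * √(m + 1 : ℕ) - 8 with hMdef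
  have hM : 0 ≤ M := by
    have : (1 : ℝ) ≤ √(m + 1 : ℕ) :=
      Real.one_le_sqrt.2 (by exact_mod_cast (by omega : 1 ≤ m + 1))
    linarith
  have hM' : 0 ≤ √2 * M := by positivity
  have hinner : rsEnergy (2 * c) (2 * (c + m + 1)) z ≤ (√2 * M) ^ 2 := by
    rw [rsEnergy_two_mul _ _ hz, mul_pow, Real.sq_sqrt (by norm_num)]
    rw [← add_assoc] at hm
    linarith
  have hright : rsEnergy (2 * c) (a + n) z ≤ (√2 * M + 3 / 2) ^ 2 := by
    rw [hb]
    interval_cases t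
    · exact hinner.trans (by gcongr; linarith)
    · exact rsEnergy_succ_top_le (by omega) hz hM' hinner
  have hleft : rsEnergy a (a + n) z ≤ (√2 * M + 3 / 2 + 3 / 2) ^ 2 := by
    rw [← ha] at hright
    interval_cases s
    · exact hright.trans (by gcongr; linarith)
    · exact rsEnergy_pred_bot_le (by omega) hz (by positivity) hright
  have hroot : √2 * √(m + 1 : ℕ) ≤ √n := by
    rw [← Real.sqrt_mul (by norm_num)]
    exact Real.sqrt_le_sqrt (by exact_mod_cast (by omega : 2 * (m + 1) ≤ n))
  refine hleft.trans ?_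
  gcongr
  rw [hMdef]
  linarith

theorem norm_eC (θ : ℝ) : ‖eC θ‖ = 1 := by
  rw [eC, show 2 * (Real.pi : ℂ) * Complex.I * θ = ((2 * Real.pi * θ : ℝ) : ℂ) * Complex.I by
    push_cast; ring]
  exact Complex.norm_exp_ofReal_mul_I _

theorem eC_nat_mul (j : ℕ) (θ : ℝ) : eC (j * θ) = eC θ ^ j := by
  rw [eC, eC, ← Complex.exp_nat_mul]
  push_cast
  ring_nf

/-- The Rudin–Shapiro sequence satisfies square-root cancellation on every interval:
`|∑_{j ∈ I} σ_j e(jθ)| ≤ C |I|^{1/2}` uniformly in `θ`. -/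
theorem rudinShapiro_exponential_sum_bound :
    ∃ C : ℝ, 0 < C ∧ ∀ a b : ℕ, ∀ θ : ℝ,
      ‖∑ j ∈ Finset.Ico a b, (rudinShapiro j : ℂ) * eC (j * θ)‖ ≤
        C * Real.sqrt ((Finset.Ico a b).card) := by
  refine ⟨10, by norm_num, fun a b θ => ?_⟩
  rcases le_or_gt b a with h | h
  · simp [h]
  obtain ⟨n, rfl⟩ := Nat.exists_eq_add_of_le h.le
  have hE := rsEnergy_le n (by omega) a (norm_eC θ)
  have hn : (1 : ℝ) ≤ √n := Real.one_le_sqrt.2 (by exact_mod_cast (by omega : 1 ≤ n))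
  have hP : ‖rsPoly a (a + n) (eC θ)‖ ≤ 10 * √n - 8 :=
    (abs_le_of_sq_le_sq' ((le_add_of_nonneg_right (sq_nonneg _)).trans hE) (by linarith)).2
  simp only [eC_nat_mul, Nat.card_Ico, Nat.add_sub_cancel_left]
  rw [rsPoly] at hP
  linarith
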